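/- For λ ∈ ℝ^p with λ_1 ≥ ⋯ ≥ λ_p ≥ 0 and any s ∈ ℝ^p, the subdifferential of the sorted ℓ1 norm at s is ∂J_λ(s) = {v ∈ ℝ^p : for each maximal atom I of s, if s_I ≠ 0 then v_I ∈ P([Π̂^{-1}_s(λ)]_I)·sgn(s_I), and if s_I = 0 then |v_I| ∈ P₀([Π̂^{-1}_s(λ)]_I)}. -/

import Mathlib

open MeasureTheory ProbabilityTheory Filter
open scoped Classical ENNReal NNReal

noncomputable section

/-- Sorted ℓ1 norm `J_λ(b) = ∑ λ_i |b|_(i)` : for a nonincreasing nonnegative `lam`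
this supremum over permutations equals the inner product of `lam` with the decreasingly
sorted absolute values of `b` (rearrangement inequality). -/
def sortedL1 {p : ℕ} (lam b : Fin p → ℝ) : ℝ :=
  ⨆ σ : Equiv.Perm (Fin p), ∑ i, lam i * |b (σ i)|

/-- `g` is a subgradient of the convex function `f` at `x`. -/
def IsSubgradientAt {p : ℕ} (f : (Fin p → ℝ) → ℝ) (x g : Fin p → ℝ) : Prop :=
  ∀ y : Fin p → ℝ, f x + ∑ i, g i * (y i - x i) ≤ f y

/-- `I` is a maximal atom of indices of `v` : all entries of `v` on `I` share the same
magnitude, and no index outside `I` has that magnitude. -/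
def IsMaximalAtom {p : ℕ} (v : Fin p → ℝ) (I : Finset (Fin p)) : Prop :=
  I.Nonempty ∧ (∀ i ∈ I, ∀ j ∈ I, |v i| = |v j|) ∧ ∀ i ∈ I, ∀ k, k ∉ I → |v i| ≠ |v k|

/-- doubly stochastic matrix (indexed by an arbitrary finite type). -/
def IsDoublyStochastic {ι : Type*} [Fintype ι] (A : ι → ι → ℝ) : Prop :=
  (∀ i j, 0 ≤ A i j) ∧ (∀ i, ∑ j, A i j = 1) ∧ (∀ j, ∑ i, A i j = 1)

/-- doubly substochastic matrix. -/
def IsDoublySubstochastic {ι : Type*} [Fintype ι] (A : ι → ι → ℝ) : Prop :=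
  (∀ i j, 0 ≤ A i j) ∧ (∀ i, ∑ j, A i j ≤ 1) ∧ (∀ j, ∑ i, A i j ≤ 1)

/-- `Π̂^{-1}_x(lam)` : the set of rearrangements of `lam` that pair the entries of `lam`
with the entries of `x` by magnitude rank (the `i`-th largest threshold is assigned to a
position holding the `i`-th largest magnitude of `x`). -/
def PiInvSet {p : ℕ} (x lam : Fin p → ℝ) : Set (Fin p → ℝ) :=
  {lamhat | ∃ σ : Equiv.Perm (Fin p),
    (∀ i j : Fin p, i ≤ j → |x (σ j)| ≤ |x (σ i)|) ∧ ∀ i, lamhat (σ i) = lam i}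

/-- The supremum in `sortedL1` is bounded below by each of its terms. -/
theorem le_sortedL1 {p : ℕ} (lam b : Fin p → ℝ) (σ : Equiv.Perm (Fin p)) :
    ∑ i, lam i * |b (σ i)| ≤ sortedL1 lam b :=
  le_ciSup (f := fun σ : Equiv.Perm (Fin p) => ∑ i, lam i * |b (σ i)|)
    (Set.finite_range _).bddAbove σ

/-- A sorting permutation attains the supremum in `sortedL1`. -/
theorem sortedL1_eq_of_antitone {p : ℕ} {lam b : Fin p → ℝ} (hlam : Antitone lam)
    {σ : Equiv.Perm (Fin p)} (hσ : Antitone fun i => |b (σ i)|) :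
    sortedL1 lam b = ∑ i, lam i * |b (σ i)| := by
  refine le_antisymm (ciSup_le fun τ => ?_) (le_sortedL1 lam b σ)
  have h := (hlam.monovary hσ).sum_mul_comp_perm_le_sum_mul (σ := τ.trans σ.symm)
  simpa using h

theorem exists_antitone_abs_comp {p : ℕ} (b : Fin p → ℝ) :
    ∃ σ : Equiv.Perm (Fin p), Antitone fun i => |b (σ i)| := by
  refine ⟨Tuple.sort fun i => -|b i|, fun i j hij => ?_⟩
  have h := Tuple.monotone_sort (fun i => -|b i|) hij
  simpa using h

/-- Two permutations sorting the magnitudes of `s` differ by a permutation preserving them. -/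
theorem abs_apply_symm_of_antitone {p : ℕ} {s : Fin p → ℝ} {σ τ : Equiv.Perm (Fin p)}
    (hσ : Antitone fun i => |s (σ i)|) (hτ : Antitone fun i => |s (τ i)|) (j : Fin p) :
    |s (σ (τ.symm j))| = |s j| := by
  have h := Tuple.unique_monotone (f := fun i => -|s i|) (σ := σ) (τ := τ)
    (fun i j hij => neg_le_neg (hσ hij)) (fun i j hij => neg_le_neg (hτ hij))
  simpa using congrFun h (τ.symm j)

/-- One-sided directional derivative of `|·|` at `a` in direction `d`. -/
def absDirDeriv (a d : ℝ) : ℝ := if a = 0 then |d| else Real.sign a * d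

theorem eventually_abs_add_mul (a d : ℝ) :
    ∀ᶠ t in nhdsWithin (0 : ℝ) (Set.Ioi 0), |a + t * d| = |a| + t * absDirDeriv a d := by
  have hc : Tendsto (fun t : ℝ => a + t * d) (nhdsWithin 0 (Set.Ioi 0)) (nhds a) := by
    have : Continuous fun t : ℝ => a + t * d := by fun_prop
    simpa using (this.tendsto 0).mono_left nhdsWithin_le_nhds
  rcases lt_trichotomy a 0 with ha | rfl | ha
  · filter_upwards [hc.eventually (eventually_lt_nhds ha)] with t ht
    rw [absDirDeriv, if_neg ha.ne, Real.sign_of_neg ha, abs_of_neg ht, abs_of_neg ha]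
    ring
  · filter_upwards [self_mem_nhdsWithin] with t ht
    simp [absDirDeriv, abs_mul, abs_of_pos (Set.mem_Ioi.1 ht)]
  · filter_upwards [hc.eventually (eventually_gt_nhds ha)] with t ht
    rw [absDirDeriv, if_neg ha.ne', Real.sign_of_pos ha, abs_of_pos ht, abs_of_pos ha]
    ring

/-- A subgradient is dominated in every direction by the directional derivative of the sorted
norm, which is computed by a permutation sorting the magnitudes of `s`. -/
theorem IsSubgradientAt.exists_sum_le {p : ℕ} {lam s v : Fin p → ℝ} (hlam : Antitone lam)
    (hv : IsSubgradientAt (sortedL1 lam) s v) (d : Fin p → ℝ) :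
    ∃ σ : Equiv.Perm (Fin p), (Antitone fun i => |s (σ i)|) ∧
      ∑ i, v i * d i ≤ ∑ j, lam (σ.symm j) * absDirDeriv (s j) (d j) := by
  have horder : ∀ᶠ t in nhdsWithin (0 : ℝ) (Set.Ioi 0), ∀ i j, |s i| < |s j| →
      |s i + t * d i| < |s j + t * d j| := by
    refine eventually_all.2 fun i => eventually_all.2 fun j => ?_
    by_cases hij : |s i| < |s j|
    · have hc (k : Fin p) :
          Tendsto (fun t : ℝ => |s k + t * d k|) (nhdsWithin 0 (Set.Ioi 0)) (nhds |s k|) := by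
        have : Continuous fun t : ℝ => |s k + t * d k| := by fun_prop
        simpa using (this.tendsto 0).mono_left nhdsWithin_le_nhds
      filter_upwards [(hc i).eventually_lt (hc j) hij] with t ht _ using ht
    · exact Eventually.of_forall fun t h => absurd h hij
  have habs : ∀ᶠ t in nhdsWithin (0 : ℝ) (Set.Ioi 0), ∀ i,
      |s i + t * d i| = |s i| + t * absDirDeriv (s i) (d i) :=
    eventually_all.2 fun i => eventually_abs_add_mul _ _
  obtain ⟨t, ⟨hord, habs⟩, ht⟩ := ((horder.and habs).and self_mem_nhdsWithin).exists
  have ht : 0 < t := ht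
  obtain ⟨σ, hσ⟩ := exists_antitone_abs_comp fun i => s i + t * d i
  have hσs : Antitone fun i => |s (σ i)| := fun i j hij =>
    not_lt.1 fun h => (hord _ _ h).not_ge (hσ hij)
  refine ⟨σ, hσs, ?_⟩
  have h := hv fun i => s i + t * d i
  rw [sortedL1_eq_of_antitone (b := fun i => s i + t * d i) hlam hσ, sortedL1_eq_of_antitone hlam hσs] at h
  simp only [habs, mul_add, Finset.sum_add_distrib, add_sub_cancel_left] at h
  have h2 : t * ∑ i, v i * d i ≤ t * ∑ i, lam i * absDirDeriv (s (σ i)) (d (σ i)) := by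
    rw [Finset.mul_sum, Finset.mul_sum]
    simpa only [mul_left_comm] using le_of_add_le_add_left h
  have h3 := le_of_mul_le_mul_left h2 ht
  refine h3.trans_eq ?_
  rw [← Equiv.sum_comp σ fun j => lam (σ.symm j) * absDirDeriv (s j) (d j)]
  simp only [σ.symm_apply_apply]

theorem isDoublySubstochastic_isCompact {ι : Type*} [Fintype ι] :
    IsCompact {A : ι → ι → ℝ | IsDoublySubstochastic A} := by
  refine (isCompact_Icc (a := (0 : ι → ι → ℝ)) (b := 1)).of_isClosed_subset ?_ ?_
  · simp only [IsDoublySubstochastic, Set.ofPred_and, Set.ofPred_forall]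
    refine .inter ?_ (.inter ?_ ?_)
    · exact isClosed_iInter fun i => isClosed_iInter fun j =>
        isClosed_le (by fun_prop) (by fun_prop)
    all_goals exact isClosed_iInter fun i => isClosed_le (by fun_prop) (by fun_prop)
  · rintro A ⟨h0, hr, -⟩
    exact ⟨fun i j => h0 i j, fun i j =>
      (Finset.single_le_sum (fun k _ => h0 i k) (Finset.mem_univ j)).trans (hr i)⟩

theorem IsDoublyStochastic.isDoublySubstochastic {ι : Type*} [Fintype ι] {A : ι → ι → ℝ}
    (hA : IsDoublyStochastic A) : IsDoublySubstochastic A :=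
  ⟨hA.1, fun i => (hA.2.1 i).le, fun j => (hA.2.2 j).le⟩

theorem isDoublyStochastic_isCompact {ι : Type*} [Fintype ι] :
    IsCompact {A : ι → ι → ℝ | IsDoublyStochastic A} := by
  refine isDoublySubstochastic_isCompact.of_isClosed_subset ?_
    fun A hA => IsDoublyStochastic.isDoublySubstochastic hA
  simp only [IsDoublyStochastic, Set.ofPred_and, Set.ofPred_forall]
  refine .inter ?_ (.inter ?_ ?_)
  · exact isClosed_iInter fun i => isClosed_iInter fun j =>
      isClosed_le (by fun_prop) (by fun_prop)
  all_goals exact isClosed_iInter fun i => isClosed_eq (by fun_prop) (by fun_prop)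

theorem isDoublySubstochastic_convex {ι : Type*} [Fintype ι] :
    Convex ℝ {A : ι → ι → ℝ | IsDoublySubstochastic A} := by
  rintro A ⟨hA0, hAr, hAc⟩ B ⟨hB0, hBr, hBc⟩ a b ha hb hab
  refine ⟨fun i j => add_nonneg (mul_nonneg ha (hA0 i j)) (mul_nonneg hb (hB0 i j)),
    fun i => ?_, fun j => ?_⟩
  · simp only [Pi.add_apply, Pi.smul_apply, smul_eq_mul, Finset.sum_add_distrib, ← Finset.mul_sum]
    nlinarith [mul_le_mul_of_nonneg_left (hAr i) ha, mul_le_mul_of_nonneg_left (hBr i) hb]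
  · simp only [Pi.add_apply, Pi.smul_apply, smul_eq_mul, Finset.sum_add_distrib, ← Finset.mul_sum]
    nlinarith [mul_le_mul_of_nonneg_left (hAc j) ha, mul_le_mul_of_nonneg_left (hBc j) hb]

theorem isDoublyStochastic_convex {ι : Type*} [Fintype ι] :
    Convex ℝ {A : ι → ι → ℝ | IsDoublyStochastic A} := by
  rintro A ⟨hA0, hAr, hAc⟩ B ⟨hB0, hBr, hBc⟩ a b ha hb hab
  refine ⟨fun i j => add_nonneg (mul_nonneg ha (hA0 i j)) (mul_nonneg hb (hB0 i j)),
    fun i => ?_, fun j => ?_⟩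
  · simp [Finset.sum_add_distrib, ← Finset.mul_sum, hAr, hBr, hab]
  · simp [Finset.sum_add_distrib, ← Finset.mul_sum, hAc, hBc, hab]

/-- A vector lies in the image of `a` under a compact convex set of matrices as soon as no linear
functional separates it from that image. -/
theorem exists_eq_sum_mul_of_forall_exists_le {ι : Type*} [Fintype ι] {S : Set (ι → ι → ℝ)}
    (hS : IsCompact S) (hconv : Convex ℝ S) (a u : ι → ℝ)
    (h : ∀ w : ι → ℝ, ∃ A ∈ S, ∑ i, w i * u i ≤ ∑ i, w i * ∑ j, A i j * a j) :
    ∃ A ∈ S, ∀ i, u i = ∑ j, A i j * a j := by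
  let T : (ι → ι → ℝ) →ₗ[ℝ] (ι → ℝ) :=
    { toFun := fun A i => ∑ j, A i j * a j
      map_add' := fun A B => by ext i; simp [add_mul, Finset.sum_add_distrib]
      map_smul' := fun c A => by ext i; simp [Finset.mul_sum, mul_assoc] }
  have hT : Continuous T := LinearMap.continuous_of_finiteDimensional T
  by_contra hu
  have hmem : u ∉ T '' S := by
    rintro ⟨A, hA, rfl⟩
    exact hu ⟨A, hA, fun i => rfl⟩
  obtain ⟨f, c, hf, hc⟩ := geometric_hahn_banach_closed_point (hconv.linear_image T)
    (hS.image hT).isClosed hmem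
  have hfx (x : ι → ℝ) : f x = ∑ i, f (Pi.single i 1) * x i := by
    conv_lhs => rw [pi_eq_sum_univ' x]
    simp [map_sum, mul_comm]
  obtain ⟨A, hA, hle⟩ := h fun i => f (Pi.single i 1)
  rw [← hfx] at hle
  have := hf _ ⟨A, hA, rfl⟩
  rw [hfx] at this
  exact (hc.trans_le hle).not_gt this

/-- Every doubly substochastic matrix is dominated entrywise by a doubly stochastic one. -/
theorem IsDoublySubstochastic.exists_le {ι : Type*} [Fintype ι] {A : ι → ι → ℝ}
    (hA : IsDoublySubstochastic A) :
    ∃ B : ι → ι → ℝ, IsDoublyStochastic B ∧ ∀ i j, A i j ≤ B i j := by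
  obtain ⟨h0, hr, hc⟩ := hA
  set r : ι → ℝ := fun i => 1 - ∑ j, A i j with hrdef
  set c : ι → ℝ := fun j => 1 - ∑ i, A i j with hcdef
  have hr0 (i) : 0 ≤ r i := sub_nonneg.2 (hr i)
  have hc0 (j) : 0 ≤ c j := sub_nonneg.2 (hc j)
  have hrc : ∑ j, c j = ∑ i, r i := by
    simp only [hrdef, hcdef, Finset.sum_sub_distrib]
    rw [Finset.sum_comm]
  have hcancel {x : ℝ} (hx : ∑ i, r i = 0 → x = 0) : x * (∑ i, r i) / ∑ i, r i = x := by
    by_cases h : ∑ i, r i = 0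
    · simp [hx h]
    · exact mul_div_cancel_right₀ _ h
  refine ⟨fun i j => A i j + r i * c j / ∑ i, r i, ⟨fun i j => ?_, fun i => ?_, fun j => ?_⟩,
    fun i j => ?_⟩
  · exact add_nonneg (h0 i j)
      (div_nonneg (mul_nonneg (hr0 i) (hc0 j)) (Finset.sum_nonneg fun i _ => hr0 i))
  · rw [Finset.sum_add_distrib, ← Finset.sum_div, ← Finset.mul_sum, hrc, hcancel]
    · simp [hrdef]
    · exact fun h => (Finset.sum_eq_zero_iff_of_nonneg fun i _ => hr0 i).1 h i (Finset.mem_univ i)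
  · rw [Finset.sum_add_distrib, ← Finset.sum_div, ← Finset.sum_mul, mul_comm, hcancel]
    · simp [hcdef]
    · exact fun h => (Finset.sum_eq_zero_iff_of_nonneg fun j _ => hc0 j).1 (hrc.trans h) j
        (Finset.mem_univ j)
  · exact le_add_of_nonneg_right
      (div_nonneg (mul_nonneg (hr0 i) (hc0 j)) (Finset.sum_nonneg fun i _ => hr0 i))

/-- The pairing of `|y|` with a doubly substochastic image of a rearrangement of `lam` is at most
the sorted norm of `y`. -/
theorem IsDoublySubstochastic.sum_le_sortedL1 {p : ℕ} {lam : Fin p → ℝ} (hlam : ∀ i, 0 ≤ lam i)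
    (σ : Equiv.Perm (Fin p)) {A : Fin p → Fin p → ℝ} (hA : IsDoublySubstochastic A)
    (y : Fin p → ℝ) :
    ∑ i, (∑ j, A i j * lam (σ.symm j)) * |y i| ≤ sortedL1 lam y := by
  obtain ⟨B, ⟨hB0, hBr, hBc⟩, hAB⟩ := hA.exists_le
  have hB : Matrix.of B ∈ doublyStochastic ℝ (Fin p) :=
    mem_doublyStochastic_iff_sum.2 ⟨hB0, hBr, hBc⟩
  obtain ⟨w, hw0, hw1, hw⟩ := exists_eq_sum_perm_of_mem_doublyStochastic hB
  have hBij (i j) : B i j = ∑ τ : Equiv.Perm (Fin p), w τ * if τ i = j then 1 else 0 := by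
    have := congrFun (congrFun hw i) j
    simpa [Matrix.sum_apply, Equiv.Perm.permMatrix, PEquiv.toMatrix_apply, eq_comm] using this.symm
  calc ∑ i, (∑ j, A i j * lam (σ.symm j)) * |y i|
      ≤ ∑ i, (∑ j, B i j * lam (σ.symm j)) * |y i| := by
        gcongr with i _ j _
        · exact hlam _
        · exact hAB i j
    _ = ∑ τ : Equiv.Perm (Fin p), w τ * ∑ i, lam (σ.symm (τ i)) * |y i| := by
        have hrow (i) : ∑ j, B i j * lam (σ.symm j) =
            ∑ τ : Equiv.Perm (Fin p), w τ * lam (σ.symm (τ i)) := by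
          simp_rw [hBij, Finset.sum_mul]
          rw [Finset.sum_comm]
          simp
        simp_rw [hrow, Finset.sum_mul, Finset.mul_sum, mul_assoc]
        exact Finset.sum_comm
    _ ≤ ∑ τ : Equiv.Perm (Fin p), w τ * sortedL1 lam y := by
        gcongr with τ _
        · exact hw0 τ
        · have := le_sortedL1 lam y (σ.trans τ.symm)
          rw [← Equiv.sum_comp (σ.trans τ.symm)]
          simpa using this
    _ = sortedL1 lam y := by rw [← Finset.sum_mul, hw1, one_mul]

theorem IsMaximalAtom.mem_iff {p : ℕ} {s : Fin p → ℝ} {I : Finset (Fin p)}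
    (hI : IsMaximalAtom s I) {i j : Fin p} (hij : |s i| = |s j|) : i ∈ I ↔ j ∈ I :=
  ⟨fun hi => by_contra fun hj => hI.2.2 i hi j hj hij,
    fun hj => by_contra fun hi => hI.2.2 j hj i hi hij.symm⟩

theorem isMaximalAtom_filter_abs_eq {p : ℕ} (s : Fin p → ℝ) (i : Fin p) :
    IsMaximalAtom s (Finset.univ.filter fun k => |s k| = |s i|) := by
  refine ⟨⟨i, by simp⟩, fun j hj k hk => ?_, fun j hj k hk h => hk ?_⟩
  · simp_all
  · simp_all

/-- On a maximal atom, two permutations sorting the magnitudes differ by a permutation of it. -/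
theorem IsMaximalAtom.exists_perm {p : ℕ} {s : Fin p → ℝ} {I : Finset (Fin p)}
    (hI : IsMaximalAtom s I) {σ τ : Equiv.Perm (Fin p)}
    (hσ : Antitone fun i => |s (σ i)|) (hτ : Antitone fun i => |s (τ i)|) :
    ∃ π : Equiv.Perm {i // i ∈ I}, ∀ i, σ.symm (π i) = τ.symm i :=
  ⟨Equiv.Perm.subtypePerm (τ.symm.trans σ) fun i => hI.mem_iff (abs_apply_symm_of_antitone hσ hτ i),
    fun _ => σ.symm_apply_apply _⟩

theorem sum_eq_sum_subtype {α : Type*} [Fintype α] (I : Finset α) {f : α → ℝ}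
    (hf : ∀ i, i ∉ I → f i = 0) : ∑ i, f i = ∑ i : {i // i ∈ I}, f i := by
  rw [Finset.sum_coe_sort I f]
  exact (Finset.sum_subset (Finset.subset_univ I) fun i _ hi => hf i hi).symm

theorem isDoublyStochastic_perm {ι : Type*} [Fintype ι] [DecidableEq ι] (π : Equiv.Perm ι) :
    IsDoublyStochastic fun i j => if π i = j then (1 : ℝ) else 0 := by
  refine ⟨fun i j => by positivity, fun i => by simp, fun j => ?_⟩
  rw [← Equiv.sum_comp π.symm]
  simp

theorem IsSubgradientAt.exists_isDoublyStochastic {p : ℕ} {lam s v : Fin p → ℝ}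
    (hlam : Antitone lam) (hv : IsSubgradientAt (sortedL1 lam) s v) {I : Finset (Fin p)}
    (hI : IsMaximalAtom s I) (hs : ∀ i ∈ I, s i ≠ 0) {σ : Equiv.Perm (Fin p)}
    (hσ : Antitone fun i => |s (σ i)|) :
    ∃ A : {i // i ∈ I} → {i // i ∈ I} → ℝ, IsDoublyStochastic A ∧
      ∀ i : {i // i ∈ I}, v i * Real.sign (s i) = ∑ j, A i j * lam (σ.symm j) := by
  refine exists_eq_sum_mul_of_forall_exists_le isDoublyStochastic_isCompact
    isDoublyStochastic_convex _ _ fun w => ?_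
  obtain ⟨τ, hτ, hle⟩ := hv.exists_sum_le hlam
    fun i => if h : i ∈ I then Real.sign (s i) * w ⟨i, h⟩ else 0
  obtain ⟨π, hπ⟩ := hI.exists_perm hσ hτ
  refine ⟨_, isDoublyStochastic_perm π, ?_⟩
  rw [sum_eq_sum_subtype I fun i hi => by simp [hi],
    sum_eq_sum_subtype I fun i hi => by simp [hi, absDirDeriv]] at hle
  refine (Finset.sum_congr rfl fun i _ => ?_).trans_le
    (hle.trans_eq (Finset.sum_congr rfl fun i _ => ?_))
  · simp only [i.2, dif_pos]
    ring
  · have h0 := hs i i.2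
    rcases Real.sign_apply_eq_of_ne_zero _ h0 with h | h <;>
      simp [absDirDeriv, h0, h, hπ, mul_comm]

theorem IsSubgradientAt.exists_isDoublySubstochastic {p : ℕ} {lam s v : Fin p → ℝ}
    (hlam : Antitone lam) (hv : IsSubgradientAt (sortedL1 lam) s v) (hlam0 : ∀ i, 0 ≤ lam i)
    {I : Finset (Fin p)} (hI : IsMaximalAtom s I) (hs : ∀ i ∈ I, s i = 0)
    {σ : Equiv.Perm (Fin p)} (hσ : Antitone fun i => |s (σ i)|) :
    ∃ A : {i // i ∈ I} → {i // i ∈ I} → ℝ, IsDoublySubstochastic A ∧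
      ∀ i : {i // i ∈ I}, |v i| = ∑ j, A i j * lam (σ.symm j) := by
  refine exists_eq_sum_mul_of_forall_exists_le (u := fun i : {i // i ∈ I} => |v i|)
    isDoublySubstochastic_isCompact isDoublySubstochastic_convex _ fun w => ?_
  obtain ⟨τ, hτ, hle⟩ := hv.exists_sum_le hlam
    fun i => if h : i ∈ I then Real.sign (v i) * max (w ⟨i, h⟩) 0 else 0
  obtain ⟨π, hπ⟩ := hI.exists_perm hσ hτ
  have hP := isDoublyStochastic_perm π
  have hdrop (i j) : (if 0 ≤ w i then if π i = j then (1 : ℝ) else 0 else 0) ≤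
      if π i = j then 1 else 0 := by split_ifs <;> norm_num
  refine ⟨fun i j => if 0 ≤ w i then if π i = j then 1 else 0 else 0,
    ⟨fun i j => by positivity,
      fun i => (Finset.sum_le_sum fun j _ => hdrop i j).trans (hP.2.1 i).le,
      fun j => (Finset.sum_le_sum fun i _ => hdrop i j).trans (hP.2.2 j).le⟩, ?_⟩
  rw [sum_eq_sum_subtype I fun i hi => by simp [hi],
    sum_eq_sum_subtype I fun i hi => by simp [hi, absDirDeriv]] at hle
  refine (Finset.sum_le_sum fun i _ => ?_).trans
    (hle.trans (Finset.sum_le_sum fun i _ => ?_))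
  · have hsign : v i * Real.sign (v i) = |v i| := by
      rcases lt_trichotomy (v i) 0 with h | h | h
      · simp [Real.sign_of_neg h, abs_of_neg h]
      · simp [h]
      · simp [Real.sign_of_pos h, abs_of_pos h]
    simp only [i.2, dif_pos, ← mul_assoc, hsign]
    rw [mul_comm]
    exact mul_le_mul_of_nonneg_left (le_max_left _ _) (abs_nonneg _)
  · have hsign : |Real.sign (v i)| ≤ 1 := by
      rcases Real.sign_apply_eq (v i) with h | h | h <;> simp [h]
    have hmax : |Real.sign (v i)| * max (w i) 0 ≤ max (w i) 0 :=
      mul_le_of_le_one_left (le_max_right _ _) hsign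
    have hrhs : w i * ∑ j : {i // i ∈ I}, (if 0 ≤ w i then if π i = j then (1 : ℝ) else 0 else 0) *
        lam (σ.symm j) = lam (τ.symm i) * max (w i) 0 := by
      by_cases h : 0 ≤ w i
      · simp [h, hπ, mul_comm]
      · simp [h, (not_le.1 h).le]
    rw [hrhs]
    refine mul_le_mul_of_nonneg_left ?_ (hlam0 _)
    rw [absDirDeriv, if_pos (hs i i.2), dif_pos i.2, abs_mul,
      abs_of_nonneg (le_max_right (w i) 0)]
    exact hmax

/-- Reordering columns turns any rearrangement of `lam` sorted along `s` into the one given by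
`σ`. -/
theorem IsMaximalAtom.exists_perm_of_mem_piInvSet {p : ℕ} {lam s lamhat : Fin p → ℝ}
    {I : Finset (Fin p)} (hI : IsMaximalAtom s I) {σ : Equiv.Perm (Fin p)}
    (hσ : Antitone fun i => |s (σ i)|) (hlamhat : lamhat ∈ PiInvSet s lam) :
    ∃ π : Equiv.Perm {i // i ∈ I}, ∀ A : {i // i ∈ I} → {i // i ∈ I} → ℝ, ∀ i,
      ∑ j, A i j * lamhat j = ∑ j, A i (π j) * lam (σ.symm j) := by
  obtain ⟨τ, hτ, hlamτ⟩ := hlamhat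
  obtain ⟨π, hπ⟩ := hI.exists_perm hσ (fun i j hij => hτ i j hij)
  refine ⟨π.symm, fun A i => ?_⟩
  rw [← Equiv.sum_comp π fun j => A i (π.symm j) * lam (σ.symm j)]
  refine Finset.sum_congr rfl fun j _ => ?_
  rw [hπ, ← hlamτ, τ.apply_symm_apply, π.symm_apply_apply]

theorem IsDoublySubstochastic.comp_perm {ι : Type*} [Fintype ι] {A : ι → ι → ℝ}
    (hA : IsDoublySubstochastic A) (π : Equiv.Perm ι) :
    IsDoublySubstochastic fun i j => A i (π j) :=
  ⟨fun i _ => hA.1 i _, fun i => (Equiv.sum_comp π (A i)).trans_le (hA.2.1 i),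
    fun _ => hA.2.2 _⟩

/-- Extension of a matrix indexed by `I` by zero. -/
def zeroExtend {α : Type*} {I : Finset α} (A : {i // i ∈ I} → {i // i ∈ I} → ℝ) (i j : α) : ℝ :=
  if h : i ∈ I ∧ j ∈ I then A ⟨i, h.1⟩ ⟨j, h.2⟩ else 0

theorem zeroExtend_apply {α : Type*} {I : Finset α} (A : {i // i ∈ I} → {i // i ∈ I} → ℝ)
    (i j : {i // i ∈ I}) : zeroExtend A i j = A i j := by
  simp [zeroExtend]

theorem zeroExtend_of_notMem_left {α : Type*} {I : Finset α}
    (A : {i // i ∈ I} → {i // i ∈ I} → ℝ) {i : α} (hi : i ∉ I) (j : α) :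
    zeroExtend A i j = 0 := by
  simp [zeroExtend, hi]

theorem zeroExtend_of_notMem_right {α : Type*} {I : Finset α}
    (A : {i // i ∈ I} → {i // i ∈ I} → ℝ) (i : α) {j : α} (hj : j ∉ I) :
    zeroExtend A i j = 0 := by
  simp [zeroExtend, hj]

theorem sum_zeroExtend_mul {α : Type*} [Fintype α] {I : Finset α}
    (A : {i // i ∈ I} → {i // i ∈ I} → ℝ) (a : α → ℝ) (i : {i // i ∈ I}) :
    ∑ j, zeroExtend A i j * a j = ∑ j, A i j * a j := by
  rw [sum_eq_sum_subtype I fun j hj => by rw [zeroExtend_of_notMem_right A _ hj, zero_mul]]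
  simp only [zeroExtend_apply]

theorem sum_zeroExtend_left {α : Type*} [Fintype α] {I : Finset α}
    (A : {i // i ∈ I} → {i // i ∈ I} → ℝ) (j : {i // i ∈ I}) :
    ∑ i, zeroExtend A i j = ∑ i, A i j := by
  rw [sum_eq_sum_subtype I fun i hi => zeroExtend_of_notMem_left A hi _]
  simp only [zeroExtend_apply]

theorem IsDoublySubstochastic.zeroExtend {α : Type*} [Fintype α] {I : Finset α}
    {A : {i // i ∈ I} → {i // i ∈ I} → ℝ} (hA : IsDoublySubstochastic A) :
    IsDoublySubstochastic (zeroExtend A) := by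
  refine ⟨fun i j => ?_, fun i => ?_, fun j => ?_⟩
  · unfold _root_.zeroExtend
    split_ifs with h
    exacts [hA.1 _ _, le_rfl]
  · by_cases hi : i ∈ I
    · have h := sum_zeroExtend_mul A (fun _ => 1) ⟨i, hi⟩
      simp only [mul_one] at h
      exact h.trans_le (hA.2.1 _)
    · simp [zeroExtend_of_notMem_left A hi]
  · by_cases hj : j ∈ I
    · exact (sum_zeroExtend_left A ⟨j, hj⟩).trans_le (hA.2.2 _)
    · simp [zeroExtend_of_notMem_right A _ hj]

/-- Doubly substochastic matrices attached to the level sets of `f` glue to a single one. -/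
theorem IsDoublySubstochastic.glue {ι : Type*} [Fintype ι] {f : ι → ℝ} {A : ℝ → ι → ι → ℝ}
    (hA : ∀ k, IsDoublySubstochastic (A (f k)))
    (hglue : ∀ i j, A (f i) i j = A (f j) i j) :
    IsDoublySubstochastic fun i j => A (f i) i j :=
  ⟨fun i j => (hA i).1 i j, fun i => (hA i).2.1 i, fun j => by
    simpa only [hglue _ j] using (hA j).2.2 j⟩

/-- A doubly substochastic image of a sorted rearrangement of `lam` that dominates `|v|` and is
tight along `s` certifies that `v` is a subgradient. -/
theorem isSubgradientAt_of_isDoublySubstochastic {p : ℕ} {lam s v : Fin p → ℝ}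
    (hlam : Antitone lam) (hlam0 : ∀ i, 0 ≤ lam i) {σ : Equiv.Perm (Fin p)}
    (hσ : Antitone fun i => |s (σ i)|) {B : Fin p → Fin p → ℝ} (hB : IsDoublySubstochastic B)
    (hlevel : ∀ i j, |s i| ≠ |s j| → B i j = 0) (hcol : ∀ j, s j ≠ 0 → ∑ i, B i j = 1)
    (hle : ∀ i, |v i| ≤ ∑ j, B i j * lam (σ.symm j))
    (heq : ∀ i, v i * s i = (∑ j, B i j * lam (σ.symm j)) * |s i|) :
    IsSubgradientAt (sortedL1 lam) s v := by
  intro y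
  have hvs : ∑ i, v i * s i = sortedL1 lam s := by
    calc ∑ i, v i * s i = ∑ i, ∑ j, B i j * (lam (σ.symm j) * |s j|) := by
          refine Finset.sum_congr rfl fun i _ => ?_
          rw [heq, Finset.sum_mul]
          refine Finset.sum_congr rfl fun j _ => ?_
          by_cases h : |s i| = |s j|
          · rw [h, mul_assoc]
          · simp [hlevel i j h]
      _ = ∑ j, lam (σ.symm j) * |s j| := by
          rw [Finset.sum_comm]
          refine Finset.sum_congr rfl fun j _ => ?_
          rw [← Finset.sum_mul]
          by_cases h : s j = 0
          · simp [h]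
          · rw [hcol j h, one_mul]
      _ = sortedL1 lam s := by
          rw [sortedL1_eq_of_antitone hlam hσ, ← Equiv.sum_comp σ]
          simp
  have hvy : ∑ i, v i * y i ≤ sortedL1 lam y := by
    refine le_trans (Finset.sum_le_sum fun i _ => ?_) (hB.sum_le_sortedL1 hlam0 σ y)
    refine (le_abs_self _).trans ?_
    rw [abs_mul]
    exact mul_le_mul_of_nonneg_right (hle i) (abs_nonneg _)
  simp only [mul_sub, Finset.sum_sub_distrib, hvs]
  linarith

/-- the subdifferential of the sorted ℓ1 norm at `s` is exactly the set of
`v` such that, blockwise on each maximal atom `I` of `s`: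
if `s_I ≠ 0` then `v_I ∈ P([Π̂^{-1}_s(λ)]_I)·sgn(s_I)` (image of a doubly stochastic
matrix), and if `s_I = 0` then `|v_I| ∈ P₀([Π̂^{-1}_s(λ)]_I)` (image of a doubly
substochastic matrix). -/
theorem statement9 {p : ℕ} (lam : Fin p → ℝ)
    (hmono : ∀ i j : Fin p, i ≤ j → lam j ≤ lam i) (hnonneg : ∀ i, 0 ≤ lam i)
    (s v : Fin p → ℝ) :
    IsSubgradientAt (sortedL1 lam) s v ↔
      ∀ I : Finset (Fin p), IsMaximalAtom s I →
        ((∀ i ∈ I, s i ≠ 0) →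
          ∃ lamhat ∈ PiInvSet s lam, ∃ A : {i // i ∈ I} → {i // i ∈ I} → ℝ,
            IsDoublyStochastic A ∧
            ∀ i : {i // i ∈ I},
              v i = (∑ j : {i // i ∈ I}, A i j * lamhat j) * Real.sign (s i)) ∧
        ((∀ i ∈ I, s i = 0) →
          ∃ lamhat ∈ PiInvSet s lam, ∃ A : {i // i ∈ I} → {i // i ∈ I} → ℝ,
            IsDoublySubstochastic A ∧
            ∀ i : {i // i ∈ I}, |v i| = ∑ j : {i // i ∈ I}, A i j * lamhat j) := by
  have hlam : Antitone lam := fun i j hij => hmono i j hij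
  obtain ⟨σ, hσ⟩ := exists_antitone_abs_comp s
  constructor
  · intro hv I hI
    have hmem : (fun j => lam (σ.symm j)) ∈ PiInvSet s lam :=
      ⟨σ, fun i j hij => hσ hij, fun i => by simp⟩
    refine ⟨fun hs => ?_, fun hs => ?_⟩
    · obtain ⟨A, hA, hAv⟩ := hv.exists_isDoublyStochastic hlam hI hs hσ
      refine ⟨_, hmem, A, hA, fun i => ?_⟩
      rw [← hAv]
      rcases Real.sign_apply_eq_of_ne_zero _ (hs i i.2) with h | h <;> simp [h]
    · obtain ⟨A, hA, hAv⟩ := hv.exists_isDoublySubstochastic hlam hnonneg hI hs hσ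
      exact ⟨_, hmem, A, hA, hAv⟩
  · intro H
    have hlevel (c : ℝ) : ∃ A : Fin p → Fin p → ℝ, IsDoublySubstochastic A ∧
        (∀ i j, |s i| ≠ c ∨ |s j| ≠ c → A i j = 0) ∧
        (∀ j, |s j| = c → s j ≠ 0 → ∑ i, A i j = 1) ∧
        ∀ i, |s i| = c → |v i| ≤ ∑ j, A i j * lam (σ.symm j) ∧
          v i * s i = (∑ j, A i j * lam (σ.symm j)) * |s i| := by
      by_cases hc : ∃ k, |s k| = c
      swap
      · refine ⟨0, ⟨by simp, by simp, by simp⟩, by simp, fun j hj => (hc ⟨j, hj⟩).elim,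
          fun i hi => (hc ⟨i, hi⟩).elim⟩
      obtain ⟨k, rfl⟩ := hc
      obtain ⟨I, hI, hIk⟩ : ∃ I, IsMaximalAtom s I ∧ ∀ i, i ∈ I ↔ |s i| = |s k| :=
        ⟨_, isMaximalAtom_filter_abs_eq s k, by simp⟩
      have hoff (A : {i // i ∈ I} → {i // i ∈ I} → ℝ) (i j : Fin p)
          (h : |s i| ≠ |s k| ∨ |s j| ≠ |s k|) : zeroExtend A i j = 0 := by
        rcases h with h | h
        · exact zeroExtend_of_notMem_left A (mt (hIk i).1 h) j
        · exact zeroExtend_of_notMem_right A i (mt (hIk j).1 h)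
      by_cases hk : s k = 0
      · have hs (i) (hi : |s i| = |s k|) : s i = 0 := by simpa [hk] using hi
        obtain ⟨lamhat, hlamhat, A, hA, hAv⟩ := (H I hI).2 fun i hi => hs i ((hIk i).1 hi)
        obtain ⟨π, hπ⟩ := hI.exists_perm_of_mem_piInvSet hσ hlamhat
        refine ⟨_, (hA.comp_perm π).zeroExtend, hoff _,
          fun j hj hj0 => (hj0 (hs j hj)).elim, fun i hi => ⟨?_, by simp [hs i hi]⟩⟩
        lift i to {i // i ∈ I} using (hIk i).2 hi
        rw [sum_zeroExtend_mul _ fun j => lam (σ.symm j), ← hπ A, hAv]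
      · have hs (i) (hi : |s i| = |s k|) : s i ≠ 0 := by
          rwa [← abs_ne_zero, hi, abs_ne_zero]
        obtain ⟨lamhat, hlamhat, A, hA, hAv⟩ := (H I hI).1 fun i hi => hs i ((hIk i).1 hi)
        obtain ⟨π, hπ⟩ := hI.exists_perm_of_mem_piInvSet hσ hlamhat
        have hAπ := hA.isDoublySubstochastic.comp_perm π
        refine ⟨_, hAπ.zeroExtend, hoff _, fun j hj _ => ?_, fun i hi => ?_⟩
        · lift j to {j // j ∈ I} using (hIk j).2 hj
          rw [sum_zeroExtend_left, hA.2.2]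
        · lift i to {i // i ∈ I} using (hIk i).2 hi
          have hsum0 : 0 ≤ ∑ j : {i // i ∈ I}, A i (π j) * lam (σ.symm j) :=
            Finset.sum_nonneg fun j _ => mul_nonneg (hAπ.1 i j) (hnonneg _)
          rw [sum_zeroExtend_mul _ fun j => lam (σ.symm j), hAv, hπ A]
          have habs := (abs_of_nonneg hsum0).le
          rcases (hs i hi).lt_or_gt with h | h
          · simp [Real.sign_of_neg h, abs_of_neg h, -Finset.univ_eq_attach, habs]
          · simp [Real.sign_of_pos h, abs_of_pos h, -Finset.univ_eq_attach, habs]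
    choose A hA hoff hcol hv using hlevel
    have hglue (i j) : A |s i| i j = A |s j| i j := by
      by_cases h : |s i| = |s j|
      · rw [h]
      · rw [hoff _ i j (.inr (Ne.symm h)), hoff _ i j (.inl h)]
    refine isSubgradientAt_of_isDoublySubstochastic hlam hnonneg hσ
      (IsDoublySubstochastic.glue (f := fun i => |s i|) (fun k => hA _) hglue)
      (fun i j h => hoff _ i j (.inr (Ne.symm h))) (fun j hj => ?_)
      (fun i => (hv _ i rfl).1) fun i => (hv _ i rfl).2
    simpa only [hglue _ j] using hcol _ j rfl hj

end
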